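/- Let G be a Γ-periodic graph with fundamental domain (E_H, V_H, ∂V), and assume Γ is residually finite: for every γ ∈ Γ with γ ≠ 1 there exists a normal subgroup of Γ of finite index not containing γ. Define L on ℓ²(V) (square-summable complex functions on V) by (L f)(v) = f(v) − ∑_{e: s e = v} (deg_G v · deg_G(t e))^{−1/2} f(t e) − ∑_{e: t e = v} (deg_G v · deg_G(s e))^{−1/2} f(s e); this is the standard Laplacian of G transported to ℓ²(V) by the unitary F ↦ (deg_G)^{1/2}·F from the weighted space ℓ²(V, deg_G). Then L is a well-defined bounded self-adjoint operator on ℓ²(V), and its spectrum is contained in the union ⋃_{k=1}^{|V_H|} J_k of the discrete Kirchhoff–Dirichlet intervals of the fundamental domain. In particular, every real number outside ⋃_k J_k lies in a spectral gap of the standard Laplacian of G. -/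

import Mathlib

open Finset

variable {V E : Type*}

/-- The degree of a vertex in the (possibly infinite) graph `G`:
the number of incidences (a loop counts twice). -/
noncomputable def degG (s t : E → V)
    [∀ v : V, Fintype {e : E // s e = v}] [∀ v : V, Fintype {e : E // t e = v}] (v : V) : ℕ :=
  Fintype.card {e : E // s e = v} + Fintype.card {e : E // t e = v}

/-- The vertex set `V_H = s(E_H) ∪ t(E_H)` of the fundamental domain. -/
noncomputable def VH [DecidableEq V] (s t : E → V) (EH : Finset E) : Finset V :=
  EH.image s ∪ EH.image t

/-- The degree of a vertex in the finite graph `H = (V_H, E_H)`. -/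
noncomputable def degH [DecidableEq V] (s t : E → V) (EH : Finset E) (v : V) : ℕ :=
  (EH.filter fun e => s e = v).card + (EH.filter fun e => t e = v).card

/-- The standard discrete Laplacian of the finite graph `H = (V_H, E_H)`,
`(Δ_H F)(v) = F(v) − (1/deg_H v)·(∑_{e∈E_H : s e = v} F(t e) + ∑_{e∈E_H : t e = v} F(s e))`. -/
noncomputable def lapH [DecidableEq V] [DecidableEq E] (s t : E → V) (EH : Finset E) :
    (↥(VH s t EH) → ℂ) →ₗ[ℂ] (↥(VH s t EH) → ℂ) where
  toFun F := fun w => F w - ((degH s t EH w.val : ℝ) : ℂ)⁻¹ *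
    ((∑ e ∈ EH.attach.filter fun e => s e.val = w.val,
        F ⟨t e.val, Finset.mem_union_right _ (Finset.mem_image_of_mem t e.2)⟩) +
      ∑ e ∈ EH.attach.filter fun e => t e.val = w.val,
        F ⟨s e.val, Finset.mem_union_left _ (Finset.mem_image_of_mem s e.2)⟩)
  map_add' F G := by
    funext w
    simp only [Pi.add_apply, Finset.sum_add_distrib]
    ring
  map_smul' c F := by
    funext w
    simp only [Pi.smul_apply, smul_eq_mul, RingHom.id_apply, ← Finset.mul_sum]
    ring

/-- The subspace of functions on `V_H` vanishing on the boundary `∂V`. -/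
noncomputable def dirDomH [DecidableEq V] (s t : E → V) (EH : Finset E) (bd : Finset V) :
    Submodule ℂ (↥(VH s t EH) → ℂ) where
  carrier := {F | ∀ w : ↥(VH s t EH), w.val ∈ bd → F w = 0}
  add_mem' := fun {F G} hF hG w hw => by simp [hF w hw, hG w hw]
  zero_mem' := fun w _ => rfl
  smul_mem' := fun c F hF w hw => by simp [hF w hw]

/-- Setting the values on the boundary `∂V` to zero. -/
noncomputable def zeroOutH [DecidableEq V] (s t : E → V) (EH : Finset E) (bd : Finset V) :
    (↥(VH s t EH) → ℂ) →ₗ[ℂ] (↥(VH s t EH) → ℂ) where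
  toFun F := fun w => if w.val ∈ bd then 0 else F w
  map_add' F G := by funext w; by_cases h : w.val ∈ bd <;> simp [h]
  map_smul' c F := by funext w; by_cases h : w.val ∈ bd <;> simp [h]

/-- The Dirichlet Laplacian `Δ_H^{∂V}` of the fundamental domain, i.e. the
compression of `Δ_H` to the functions vanishing on `∂V`. -/
noncomputable def dirLapH [DecidableEq V] [DecidableEq E] (s t : E → V) (EH : Finset E)
    (bd : Finset V) : dirDomH s t EH bd →ₗ[ℂ] dirDomH s t EH bd :=
  LinearMap.codRestrict (dirDomH s t EH bd)
    ((zeroOutH s t EH bd).comp ((lapH s t EH).comp (dirDomH s t EH bd).subtype))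
    (fun F => by intro w hw; simp [zeroOutH, hw])

open scoped ComplexConjugate

theorem natCard_subtype_comp_eq_of_card_fiber_eq {ι κ : Type*} [Fintype ι] [Fintype κ]
    (ν : ι → ℝ) (μ : κ → ℝ)
    (h : ∀ x : ℝ, (univ.filter fun i => ν i = x).card = (univ.filter fun i => μ i = x).card)
    (p : ℝ → Prop) : Nat.card {i // p (ν i)} = Nat.card {i // p (μ i)} := by
  classical
  have key : Multiset.map ν univ.val = Multiset.map μ univ.val := by
    ext x
    have := h x
    simpa [Multiset.count_map, Finset.card_def, eq_comm] using this
  have := congrArg (Multiset.countP p) key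
  simpa [Multiset.countP_map, Nat.card_eq_fintype_card, Fintype.card_subtype, Finset.card_def]
    using this

/-- Spectral theorem for an operator which is symmetric for a given inner product. -/
theorem exists_eigenbasis_of_core {U : Type*} [AddCommGroup U] [Module ℂ U]
    [FiniteDimensional ℂ U] (c : InnerProductSpace.Core ℂ U) (A : U →ₗ[ℂ] U)
    (hA : ∀ x y, c.inner (A x) y = c.inner x (A y)) {m : ℕ} (μ : Fin m → ℝ)
    (hcount : ∀ x : ℝ, (univ.filter fun i => μ i = x).card =
      Module.finrank ℂ (LinearMap.ker (A - (x : ℂ) • (LinearMap.id : U →ₗ[ℂ] U)))) :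
    ∃ (n : ℕ) (b : Module.Basis (Fin n) ℂ U) (ν : Fin n → ℝ),
      (∀ p : ℝ → Prop, Nat.card {i // p (ν i)} = Nat.card {i // p (μ i)}) ∧
      (∀ v w, c.inner v w = ∑ i, conj (b.repr v i) * b.repr w i) ∧
      ∀ v i, b.repr (A v) i = (ν i : ℂ) * b.repr v i := by
  let _ : NormedAddCommGroup U := c.toNormedAddCommGroup
  let _ : InnerProductSpace ℂ U := InnerProductSpace.ofCore c.toCore
  have hS : A.IsSymmetric := fun x y => hA x y
  refine ⟨Module.finrank ℂ U, (hS.eigenvectorBasis rfl).toBasis, hS.eigenvalues rfl, ?_, ?_, ?_⟩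
  · refine natCard_subtype_comp_eq_of_card_fiber_eq _ _ fun x => ?_
    rw [hcount x]
    have := hS.card_filter_eigenvalues_eq rfl (x : ℂ)
    simp only [Complex.coe_algebraMap, Complex.ofReal_inj] at this
    rw [this, Module.End.eigenspace_def]
    rfl
  · intro v w
    have := (hS.eigenvectorBasis rfl).repr.inner_map_map v w
    rw [PiLp.inner_apply] at this
    change inner ℂ v w = _
    rw [← this]
    simp [mul_comm]
  · intro v i
    simp [hS.eigenvectorBasis_apply_self_apply]

/-- Lower form bound: the eigenvectors of eigenvalue at most `l` are detected by
linear functionals. -/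
theorem exists_functionals_of_eigenbasis {U : Type*} [AddCommGroup U] [Module ℂ U] {n : ℕ}
    (b : Module.Basis (Fin n) ℂ U) (ν : Fin n → ℝ) (l : ℝ) {k : ℕ}
    (hk : Nat.card {i // ν i ≤ l} = k) :
    ∃ (φ : Fin k → U →ₗ[ℂ] ℂ) (c C : ℝ), 0 < c ∧ 0 ≤ C ∧ ∀ g,
      (c + l) * ∑ i, ‖b.repr g i‖ ^ 2 ≤
        ∑ i, ν i * ‖b.repr g i‖ ^ 2 + C * ∑ j, ‖φ j g‖ ^ 2 := by
  classical
  obtain ⟨e⟩ : Nonempty (Fin k ≃ {i // ν i ≤ l}) :=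
    ⟨(finCongr hk.symm).trans (Finite.equivFin _).symm⟩
  obtain ⟨c, hc, hcν⟩ : ∃ c > 0, ∀ i, ¬ ν i ≤ l → c + l ≤ ν i := by
    by_cases hne : (univ.filter fun i => ¬ ν i ≤ l).Nonempty
    · obtain ⟨i₀, hi₀, hmin⟩ := Finset.exists_min_image _ ν hne
      refine ⟨ν i₀ - l, by simpa using hi₀, fun i hi => ?_⟩
      have := hmin i (by simpa using hi)
      linarith
    · refine ⟨1, one_pos, fun i hi => absurd ⟨i, by simpa using hi⟩ hne⟩
  set C : ℝ := ∑ i, |c + l - ν i| with hCdef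
  have hC : ∀ i, c + l - ν i ≤ C := fun i => (le_abs_self _).trans
    (Finset.single_le_sum (f := fun i => |c + l - ν i|) (fun _ _ => abs_nonneg _) (mem_univ i))
  refine ⟨fun j => b.coord (e j), c, C, hc, Finset.sum_nonneg fun _ _ => abs_nonneg _,
    fun g => ?_⟩
  have h1 : ∑ j, ‖b.coord (e j : Fin n) g‖ ^ 2 =
      ∑ i ∈ univ.filter (fun i => ν i ≤ l), ‖b.repr g i‖ ^ 2 := by
    rw [Equiv.sum_comp e (fun i => ‖b.coord (i : Fin n) g‖ ^ 2)]
    rw [← Finset.sum_subtype_eq_sum_filter]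
    exact Finset.sum_congr (by ext; simp) fun _ _ => rfl
  rw [h1, Finset.sum_filter, Finset.mul_sum, Finset.mul_sum, ← Finset.sum_add_distrib]
  refine Finset.sum_le_sum fun i _ => ?_
  have h0 := sq_nonneg ‖b.repr g i‖
  split_ifs with h
  · nlinarith [hC i]
  · nlinarith [hcν i h]

/-- Upper form bound: the span of eigenvectors of eigenvalue less than `l`. -/
theorem exists_vectors_of_eigenbasis {U : Type*} [AddCommGroup U] [Module ℂ U] {n : ℕ}
    (b : Module.Basis (Fin n) ℂ U) (ν : Fin n → ℝ) (l : ℝ) {k : ℕ}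
    (hk : k ≤ Nat.card {i // ν i < l}) :
    ∃ (ψ : Fin k → U) (c : ℝ), 0 < c ∧ ∀ x : Fin k → ℂ,
      ∑ i, ν i * ‖b.repr (∑ j, x j • ψ j) i‖ ^ 2 + c * ∑ j, ‖x j‖ ^ 2 ≤
        l * ∑ i, ‖b.repr (∑ j, x j • ψ j) i‖ ^ 2 := by
  classical
  let e : Fin k ↪ Fin n := ((Fin.castLEEmb hk).trans
    (Finite.equivFin {i // ν i < l}).symm.toEmbedding).trans (Function.Embedding.subtype _)
  have he : ∀ j, ν (e j) < l := fun j =>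
    ((Finite.equivFin {i // ν i < l}).symm (Fin.castLE hk j)).2
  obtain ⟨c, hc, hcν⟩ : ∃ c > 0, ∀ j, ν (e j) + c ≤ l := by
    by_cases hne : (univ : Finset (Fin k)).Nonempty
    · obtain ⟨i₀, hi₀, hmax⟩ := Finset.exists_max_image _ (fun j => ν (e j)) hne
      refine ⟨l - ν (e i₀), by linarith [he i₀], fun i => ?_⟩
      have := hmax i (mem_univ i)
      linarith
    · exact ⟨1, one_pos, fun i => absurd ⟨i, mem_univ i⟩ hne⟩
  refine ⟨fun j => b (e j), c, hc, fun x => ?_⟩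
  have hrepr : ∀ i, b.repr (∑ j, x j • b (e j)) i = ∑ j, if e j = i then x j else 0 := by
    intro i
    simp [Finsupp.single_apply]
  have hsum : ∀ w : Fin n → ℝ, ∑ i, w i * ‖b.repr (∑ j, x j • b (e j)) i‖ ^ 2 =
      ∑ j, w (e j) * ‖x j‖ ^ 2 := by
    intro w
    have hz : ∀ i, i ∉ univ.map e →
        w i * ‖b.repr (∑ j, x j • b (e j)) i‖ ^ 2 = 0 := by
      intro i hi
      rw [hrepr, Finset.sum_eq_zero]
      · simp
      · intro j _
        rw [if_neg]
        rintro rfl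
        exact hi (by simp)
    rw [← Finset.sum_subset (Finset.subset_univ (univ.map e)) fun i _ hi => hz i hi,
      Finset.sum_map]
    refine Finset.sum_congr rfl fun j _ => ?_
    rw [hrepr]
    simp [e.injective.eq_iff]
  have h1 := hsum ν
  have h2 := hsum fun _ => l
  beta_reduce
  rw [h1, Finset.mul_sum, Finset.mul_sum, h2, ← Finset.sum_add_distrib]
  refine Finset.sum_le_sum fun j _ => ?_
  nlinarith [hcν j, sq_nonneg ‖x j‖]

section FiniteGraph

variable {W EE : Type*} [Fintype EE]

/-- The sesquilinear form of the degree-weighted space of a finite graph, as a sum over edges. -/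
noncomputable def edgeInner (σ τ : EE → W) (F G : W → ℂ) : ℂ :=
  ∑ e, (conj (F (σ e)) * G (σ e) + conj (F (τ e)) * G (τ e))

/-- The squared norm of the degree-weighted space of a finite graph, as a sum over edges. -/
noncomputable def edgeNormSq (σ τ : EE → W) (g : W → ℂ) : ℝ :=
  ∑ e, (‖g (σ e)‖ ^ 2 + ‖g (τ e)‖ ^ 2)

/-- The Dirichlet energy of a function on a finite graph. -/
noncomputable def edgeEnergy (σ τ : EE → W) (g : W → ℂ) : ℝ :=
  ∑ e, ‖g (τ e) - g (σ e)‖ ^ 2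

theorem edgeInner_self (σ τ : EE → W) (g : W → ℂ) :
    edgeInner σ τ g g = (edgeNormSq σ τ g : ℂ) := by
  simp [edgeInner, edgeNormSq, Complex.conj_mul']

/-- The edge form, pulled back along an injective linear map, is an inner product. -/
@[reducible]
noncomputable def edgeCore (σ τ : EE → W) (hστ : ∀ w, ∃ e, σ e = w ∨ τ e = w)
    {U : Type*} [AddCommGroup U] [Module ℂ U] (ι : U →ₗ[ℂ] (W → ℂ))
    (hι : Function.Injective ι) : InnerProductSpace.Core ℂ U where
  inner F G := edgeInner σ τ (ι F) (ι G)
  conj_inner_symm F G := by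
    simp [edgeInner, mul_comm]
  re_inner_nonneg F := by
    have h : 0 ≤ edgeNormSq σ τ (ι F) := Finset.sum_nonneg fun e _ => by positivity
    rw [edgeInner_self]
    simpa using h
  add_left F G K := by
    simp only [edgeInner, map_add, Pi.add_apply, ← Finset.sum_add_distrib]
    exact Finset.sum_congr rfl fun e _ => by ring
  smul_left F G r := by
    simp only [edgeInner, map_smul, Pi.smul_apply, smul_eq_mul, map_mul, Finset.mul_sum]
    exact Finset.sum_congr rfl fun e _ => by ring
  definite F hF := by
    rw [edgeInner_self, Complex.ofReal_eq_zero, edgeNormSq,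
      Finset.sum_eq_zero_iff_of_nonneg fun e _ => by positivity] at hF
    apply hι
    rw [map_zero]
    funext w
    obtain ⟨e, he⟩ := hστ w
    have h := hF e (Finset.mem_univ e)
    have h1 : ‖ι F (σ e)‖ ^ 2 = 0 := by
      nlinarith [sq_nonneg ‖ι F (σ e)‖, sq_nonneg ‖ι F (τ e)‖]
    have h2 : ‖ι F (τ e)‖ ^ 2 = 0 := by
      nlinarith [sq_nonneg ‖ι F (σ e)‖, sq_nonneg ‖ι F (τ e)‖]
    rcases he with rfl | rfl
    · simpa using h1
    · simpa using h2

/-- Spectral decomposition of an operator whose form is the Dirichlet energy. -/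
theorem exists_eigenbasis_of_edgeEnergy (σ τ : EE → W) (hστ : ∀ w, ∃ e, σ e = w ∨ τ e = w)
    {U : Type*} [AddCommGroup U] [Module ℂ U] [FiniteDimensional ℂ U] (ι : U →ₗ[ℂ] (W → ℂ))
    (hι : Function.Injective ι) (A : U →ₗ[ℂ] U)
    (hA : ∀ F G, edgeInner σ τ (ι F) (ι (A G)) =
      ∑ e, conj (ι F (τ e) - ι F (σ e)) * (ι G (τ e) - ι G (σ e)))
    {m : ℕ} (μ : Fin m → ℝ)
    (hcount : ∀ x : ℝ, (univ.filter fun i => μ i = x).card =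
      Module.finrank ℂ (LinearMap.ker (A - (x : ℂ) • (LinearMap.id : U →ₗ[ℂ] U)))) :
    ∃ (n : ℕ) (b : Module.Basis (Fin n) ℂ U) (ν : Fin n → ℝ),
      (∀ p : ℝ → Prop, Nat.card {i // p (ν i)} = Nat.card {i // p (μ i)}) ∧
      (∀ g, edgeNormSq σ τ (ι g) = ∑ i, ‖b.repr g i‖ ^ 2) ∧
      ∀ g, edgeEnergy σ τ (ι g) = ∑ i, ν i * ‖b.repr g i‖ ^ 2 := by
  obtain ⟨n, b, ν, hp, hinner, hrepr⟩ := exists_eigenbasis_of_core (edgeCore σ τ hστ ι hι) A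
    (fun F G => by
      change edgeInner σ τ (ι (A F)) (ι G) = edgeInner σ τ (ι F) (ι (A G))
      have h : edgeInner σ τ (ι (A F)) (ι G) = conj (edgeInner σ τ (ι G) (ι (A F))) :=
        ((edgeCore σ τ hστ ι hι).conj_inner_symm (A F) G).symm
      rw [h, hA, hA, map_sum]
      simp only [map_mul, Complex.conj_conj]
      exact Finset.sum_congr rfl fun e _ => mul_comm _ _) μ hcount
  refine ⟨n, b, ν, hp, fun g => ?_, fun g => ?_⟩
  · rw [← Complex.ofReal_inj, ← edgeInner_self]
    refine (hinner g g).trans ?_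
    simp [Complex.conj_mul']
  · rw [← Complex.ofReal_inj]
    have h := (hA g g).symm.trans (hinner g (A g))
    simp only [hrepr, Complex.conj_mul', mul_left_comm _ (ν _ : ℂ)] at h
    simpa [edgeEnergy] using h

end FiniteGraph

section Frozen

variable [DecidableEq V] (s t : E → V) (EH : Finset E)

/-- Initial vertex, as a map between the finite sets of the fundamental domain. -/
def srcH (e : ↥EH) : ↥(VH s t EH) :=
  ⟨s e.val, Finset.mem_union_left _ (Finset.mem_image_of_mem s e.2)⟩

/-- Terminal vertex, as a map between the finite sets of the fundamental domain. -/
def tgtH (e : ↥EH) : ↥(VH s t EH) :=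
  ⟨t e.val, Finset.mem_union_right _ (Finset.mem_image_of_mem t e.2)⟩

theorem exists_srcH_or_tgtH (w : ↥(VH s t EH)) :
    ∃ e, srcH s t EH e = w ∨ tgtH s t EH e = w := by
  obtain ⟨w, hw⟩ := w
  rcases Finset.mem_union.1 hw with h | h <;> obtain ⟨e, he, rfl⟩ := Finset.mem_image.1 h
  · exact ⟨⟨e, he⟩, Or.inl rfl⟩
  · exact ⟨⟨e, he⟩, Or.inr rfl⟩

theorem degH_eq (w : ↥(VH s t EH)) : degH s t EH w.val =
    (univ.filter fun e => srcH s t EH e = w).card +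
      (univ.filter fun e => tgtH s t EH e = w).card := by
  unfold degH
  congr 1
  · rw [← Finset.card_map (Function.Embedding.subtype _)]
    congr 1
    ext e
    simp [srcH, Subtype.ext_iff, and_comm]
  · rw [← Finset.card_map (Function.Embedding.subtype _)]
    congr 1
    ext e
    simp [tgtH, Subtype.ext_iff, and_comm]

theorem degH_ne_zero (w : ↥(VH s t EH)) : degH s t EH w.val ≠ 0 := by
  rw [degH_eq]
  obtain ⟨e, he | he⟩ := exists_srcH_or_tgtH s t EH w
  · have : 0 < (univ.filter fun e => srcH s t EH e = w).card :=
      Finset.card_pos.2 ⟨e, by simpa using he⟩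
    omega
  · have : 0 < (univ.filter fun e => tgtH s t EH e = w).card :=
      Finset.card_pos.2 ⟨e, by simpa using he⟩
    omega

theorem edgeInner_eq_sum_degH (F G : ↥(VH s t EH) → ℂ) :
    edgeInner (srcH s t EH) (tgtH s t EH) F G =
      ∑ w : ↥(VH s t EH), (degH s t EH w.val : ℂ) * (conj (F w) * G w) := by
  simp only [degH_eq, Nat.cast_add, add_mul, edgeInner, Finset.sum_add_distrib]
  congr 1
  · rw [← Finset.sum_fiberwise univ (srcH s t EH)]
    refine Finset.sum_congr rfl fun w _ => ?_
    rw [← nsmul_eq_mul, ← Finset.sum_const]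
    refine Finset.sum_congr rfl fun e he => ?_
    rw [(Finset.mem_filter.1 he).2]
  · rw [← Finset.sum_fiberwise univ (tgtH s t EH)]
    refine Finset.sum_congr rfl fun w _ => ?_
    rw [← nsmul_eq_mul, ← Finset.sum_const]
    refine Finset.sum_congr rfl fun e he => ?_
    rw [(Finset.mem_filter.1 he).2]

theorem lapH_apply [DecidableEq E] (F : ↥(VH s t EH) → ℂ) (w : ↥(VH s t EH)) :
    lapH s t EH F w = F w - (degH s t EH w.val : ℂ)⁻¹ *
      ((∑ e ∈ univ.filter fun e => srcH s t EH e = w, F (tgtH s t EH e)) +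
        ∑ e ∈ univ.filter fun e => tgtH s t EH e = w, F (srcH s t EH e)) := by
  simp only [lapH, LinearMap.coe_mk, AddHom.coe_mk, srcH, tgtH, Subtype.ext_iff,
    Finset.univ_eq_attach]
  norm_num

theorem edgeInner_lapH [DecidableEq E] (F G : ↥(VH s t EH) → ℂ) :
    edgeInner (srcH s t EH) (tgtH s t EH) F (lapH s t EH G) =
      ∑ e, conj (F (tgtH s t EH e) - F (srcH s t EH e)) *
        (G (tgtH s t EH e) - G (srcH s t EH e)) := by
  have h1 : ∀ w : ↥(VH s t EH), (degH s t EH w.val : ℂ) * (conj (F w) * lapH s t EH G w) =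
      (degH s t EH w.val : ℂ) * (conj (F w) * G w) -
      ((∑ e ∈ univ.filter fun e => srcH s t EH e = w,
          conj (F (srcH s t EH e)) * G (tgtH s t EH e)) +
        ∑ e ∈ univ.filter fun e => tgtH s t EH e = w,
          conj (F (tgtH s t EH e)) * G (srcH s t EH e)) := by
    intro w
    have hd : (degH s t EH w.val : ℂ) ≠ 0 := Nat.cast_ne_zero.2 (degH_ne_zero s t EH w)
    have h2 : (∑ e ∈ univ.filter fun e => srcH s t EH e = w,
          conj (F (srcH s t EH e)) * G (tgtH s t EH e)) =
        conj (F w) * ∑ e ∈ univ.filter fun e => srcH s t EH e = w, G (tgtH s t EH e) := by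
      rw [Finset.mul_sum]
      exact Finset.sum_congr rfl fun e he => by rw [(Finset.mem_filter.1 he).2]
    have h3 : (∑ e ∈ univ.filter fun e => tgtH s t EH e = w,
          conj (F (tgtH s t EH e)) * G (srcH s t EH e)) =
        conj (F w) * ∑ e ∈ univ.filter fun e => tgtH s t EH e = w, G (srcH s t EH e) := by
      rw [Finset.mul_sum]
      exact Finset.sum_congr rfl fun e he => by rw [(Finset.mem_filter.1 he).2]
    rw [h2, h3, lapH_apply]
    field_simp
  rw [edgeInner_eq_sum_degH, Finset.sum_congr rfl fun w _ => h1 w, Finset.sum_sub_distrib,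
    ← edgeInner_eq_sum_degH, Finset.sum_add_distrib, Finset.sum_fiberwise, Finset.sum_fiberwise,
    edgeInner, ← Finset.sum_add_distrib, ← Finset.sum_sub_distrib]
  refine Finset.sum_congr rfl fun e _ => ?_
  rw [map_sub]
  ring

/-- Kirchhoff lower bound for the Dirichlet energy of the fundamental domain. -/
theorem exists_kirchhoff_bound [DecidableEq E] {m : ℕ} (μ : Fin m → ℝ)
    (hcount : ∀ x : ℝ, (univ.filter fun i => μ i = x).card =
      Module.finrank ℂ (LinearMap.ker (lapH s t EH -
        (x : ℂ) • (LinearMap.id : (↥(VH s t EH) → ℂ) →ₗ[ℂ] (↥(VH s t EH) → ℂ)))))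
    (l : ℝ) {k : ℕ} (hk : Nat.card {i // μ i ≤ l} = k) :
    ∃ (φ : Fin k → ↥(VH s t EH) → ℂ) (c C : ℝ), 0 < c ∧ 0 ≤ C ∧ ∀ g : ↥(VH s t EH) → ℂ,
      (c + l) * edgeNormSq (srcH s t EH) (tgtH s t EH) g ≤
        edgeEnergy (srcH s t EH) (tgtH s t EH) g + C * ∑ j, ‖∑ w, φ j w * g w‖ ^ 2 := by
  obtain ⟨n, b, ν, hp, hn, hq⟩ := exists_eigenbasis_of_edgeEnergy (srcH s t EH) (tgtH s t EH)
    (exists_srcH_or_tgtH s t EH) LinearMap.id Function.injective_id (lapH s t EH)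
    (fun F G => edgeInner_lapH s t EH F G) μ hcount
  obtain ⟨φ, c, C, hc, hC, h⟩ := exists_functionals_of_eigenbasis b ν l
    ((hp fun x => x ≤ l).trans hk)
  refine ⟨fun j w => φ j (Pi.single w 1), c, C, hc, hC, fun g => ?_⟩
  have hφ : ∀ j, φ j g = ∑ w, φ j (Pi.single w 1) * g w := by
    intro j
    conv_lhs => rw [pi_eq_sum_univ' g, map_sum]
    refine Finset.sum_congr rfl fun w _ => ?_
    rw [map_smul, smul_eq_mul, mul_comm]
  have hn' := hn g
  have hq' := hq g
  simp only [LinearMap.id_apply] at hn' hq'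
  simp only [hn', hq', ← hφ]
  exact h g

/-- Dirichlet upper bound for the energy of the fundamental domain. -/
theorem exists_dirichlet_bound [DecidableEq E] (bd : Finset V) {m : ℕ} (μD : Fin m → ℝ)
    (hcountD : ∀ x : ℝ, (univ.filter fun i => μD i = x).card =
      Module.finrank ℂ (LinearMap.ker (dirLapH s t EH bd -
        (x : ℂ) • (LinearMap.id : dirDomH s t EH bd →ₗ[ℂ] dirDomH s t EH bd))))
    (l : ℝ) {k : ℕ} (hk : k ≤ Nat.card {i // μD i < l}) :
    ∃ (ψ : Fin k → ↥(VH s t EH) → ℂ) (c : ℝ), 0 < c ∧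
      (∀ j w, w.val ∈ bd → ψ j w = 0) ∧ ∀ x : Fin k → ℂ,
      edgeEnergy (srcH s t EH) (tgtH s t EH) (fun w => ∑ j, x j * ψ j w) +
          c * ∑ j, ‖x j‖ ^ 2 ≤
        l * edgeNormSq (srcH s t EH) (tgtH s t EH) (fun w => ∑ j, x j * ψ j w) := by
  obtain ⟨n, b, ν, hp, hn, hq⟩ := exists_eigenbasis_of_edgeEnergy (srcH s t EH) (tgtH s t EH)
    (exists_srcH_or_tgtH s t EH) (dirDomH s t EH bd).subtype
    (dirDomH s t EH bd).injective_subtype (dirLapH s t EH bd)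
    (fun F G => by
      rw [← edgeInner_lapH, edgeInner_eq_sum_degH, edgeInner_eq_sum_degH]
      refine Finset.sum_congr rfl fun w _ => ?_
      by_cases hw : w.val ∈ bd
      · have : F.val w = 0 := F.2 w hw
        simp [this]
      · simp [dirLapH, zeroOutH, hw]) μD hcountD
  obtain ⟨ψ, c, hc, h⟩ := exists_vectors_of_eigenbasis b ν l (k := k)
    (hk.trans_eq (hp fun x => x < l).symm)
  refine ⟨fun j => ψ j, c, hc, fun j w hw => (ψ j).2 w hw, fun x => ?_⟩
  have hx : (fun w => ∑ j, x j * (ψ j).val w) =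
      (dirDomH s t EH bd).subtype (∑ j, x j • ψ j) := by
    funext w
    simp
  rw [hx, hn, hq]
  exact h x

end Frozen

section SquareSummable

open ContinuousLinearMap

/-- The Hilbert space of square-summable complex functions. -/
noncomputable abbrev SqSum (X : Type*) := lp (fun _ : X => ℂ) 2

theorem SqSum.hasSum_norm_sq {X : Type*} (f : SqSum X) :
    HasSum (fun x => ‖f x‖ ^ 2) (‖f‖ ^ 2) := by
  have := lp.hasSum_norm (p := 2) (by norm_num) f
  simpa using this

theorem SqSum.sum_norm_sq_le {X : Type*} (f : SqSum X) (S : Finset X) :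
    ∑ x ∈ S, ‖f x‖ ^ 2 ≤ ‖f‖ ^ 2 :=
  sum_le_hasSum S (fun _ _ => by positivity) (SqSum.hasSum_norm_sq f)

/-- Weighted pull-back along a map is bounded when the weights are square-summable along
the fibres, uniformly. -/
theorem exists_weighted_pullback {X Y : Type*} (σ : X → Y) (a : X → ℂ) (M : ℝ)
    (hM : ∀ (y : Y) (S : Finset X), (∀ x ∈ S, σ x = y) → ∑ x ∈ S, ‖a x‖ ^ 2 ≤ M) :
    ∃ K : SqSum Y →L[ℂ] SqSum X, ∀ (f : SqSum Y) (x : X), K f x = a x * f (σ x) := by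
  classical
  have hfin : ∀ (f : SqSum Y) (S : Finset X),
      ∑ x ∈ S, ‖a x * f (σ x)‖ ^ 2 ≤ |M| * ‖f‖ ^ 2 := by
    intro f S
    rw [← Finset.sum_fiberwise_of_maps_to (g := σ) (t := S.image σ)
      fun x hx => Finset.mem_image_of_mem σ hx]
    refine (Finset.sum_le_sum (g := fun y => |M| * ‖f y‖ ^ 2) fun y _ => ?_).trans ?_
    · have h1 : ∑ x ∈ S with σ x = y, ‖a x * f (σ x)‖ ^ 2 =
          (∑ x ∈ S with σ x = y, ‖a x‖ ^ 2) * ‖f y‖ ^ 2 := by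
        rw [Finset.sum_mul]
        refine Finset.sum_congr rfl fun x hx => ?_
        rw [norm_mul, mul_pow, (Finset.mem_filter.1 hx).2]
      rw [h1]
      exact mul_le_mul_of_nonneg_right
        ((hM y _ fun x hx => (Finset.mem_filter.1 hx).2).trans (le_abs_self M)) (sq_nonneg _)
    · rw [← Finset.mul_sum]
      exact mul_le_mul_of_nonneg_left (SqSum.sum_norm_sq_le f _) (abs_nonneg M)
  have hmem : ∀ f : SqSum Y, Memℓp (fun x => a x * f (σ x)) 2 := fun f =>
    memℓp_gen' (C := |M| * ‖f‖ ^ 2) fun S => by simpa using hfin f S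
  let K₀ : SqSum Y →ₗ[ℂ] SqSum X :=
    { toFun := fun f => ⟨fun x => a x * f (σ x), hmem f⟩
      map_add' := fun f g => by
        ext x
        exact mul_add _ _ _
      map_smul' := fun c f => by
        ext x
        exact mul_left_comm _ _ _ }
  refine ⟨K₀.mkContinuous (Real.sqrt |M|) fun f => ?_, fun f x => rfl⟩
  refine lp.norm_le_of_forall_sum_le (p := 2) (by norm_num) (by positivity) fun S => ?_
  have h : ∑ x ∈ S, ‖K₀ f x‖ ^ 2 ≤ |M| * ‖f‖ ^ 2 := hfin f S
  have h2 : (Real.sqrt |M| * ‖f‖) ^ 2 = |M| * ‖f‖ ^ 2 := by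
    rw [mul_pow, Real.sq_sqrt (abs_nonneg M)]
  rw [← h2] at h
  simpa using h

theorem exists_permutation_operator {X Y : Type*} (e : X ≃ Y) :
    ∃ K : SqSum Y →L[ℂ] SqSum X, ∀ (f : SqSum Y) (x : X), K f x = f (e x) := by
  obtain ⟨K, hK⟩ := exists_weighted_pullback e (fun _ => 1) 1 fun y S hS => by
    have : S.card ≤ 1 := Finset.card_le_one.2 fun x hx x' hx' =>
      e.injective ((hS x hx).trans (hS x' hx').symm)
    simpa using this
  exact ⟨K, fun f x => by rw [hK, one_mul]⟩

/-- The operator of composition with a bijection. -/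
noncomputable def permOp {X Y : Type*} (e : X ≃ Y) : SqSum Y →L[ℂ] SqSum X :=
  (exists_permutation_operator e).choose

theorem permOp_apply {X Y : Type*} (e : X ≃ Y) (f : SqSum Y) (x : X) :
    permOp e f x = f (e x) :=
  (exists_permutation_operator e).choose_spec f x

theorem adjoint_permOp {X Y : Type*} (e : X ≃ Y) : adjoint (permOp e) = permOp e.symm := by
  symm
  rw [eq_adjoint_iff]
  intro f g
  rw [lp.inner_eq_tsum, lp.inner_eq_tsum, ← e.tsum_eq]
  simp [permOp_apply]

theorem permOp_single {X Y : Type*} [DecidableEq X] [DecidableEq Y] (e : X ≃ Y) (y : Y) (c : ℂ) :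
    permOp e (lp.single 2 y c) = lp.single 2 (e.symm y) c := by
  ext x
  simp only [permOp_apply, lp.single_apply, Pi.single_apply, Equiv.eq_symm_apply]

theorem hasSum_comp_single {X : Type*} [DecidableEq X] (A B : SqSum X →L[ℂ] SqSum X) (x y : X) :
    HasSum (fun z => A (lp.single 2 z 1) x * B (lp.single 2 y 1) z)
      ((A * B) (lp.single 2 y 1) x) := by
  have h1 := (lp.hasSum_single (p := 2) (by norm_num) (B (lp.single 2 y 1))).mapL A
  have h2 := h1.mapL (innerSL ℂ (lp.single 2 x (1 : ℂ)))
  simp only [innerSL_apply_apply, lp.inner_single_left] at h2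
  have h3 : ∀ z : ℂ, inner ℂ (1 : ℂ) z = z := by simp
  have h4 : ∀ z, A (lp.single 2 z (B (lp.single 2 y 1) z)) x =
      A (lp.single 2 z 1) x * B (lp.single 2 y 1) z := by
    intro z
    have : lp.single (E := fun _ : X => ℂ) 2 z (B (lp.single 2 y 1) z) =
        B (lp.single 2 y 1) z • lp.single 2 z (1 : ℂ) := by
      rw [← lp.single_smul, smul_eq_mul, mul_one]
    rw [this, map_smul, lp.coeFn_smul, Pi.smul_apply, smul_eq_mul, mul_comm]
  simp only [h3, h4] at h2
  exact h2

/-- Left translation by a group element on finitely many copies of the group. -/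
def leftPerm {Γ : Type*} [Group Γ] (ι : Type*) (g : Γ) : Γ × ι ≃ Γ × ι :=
  (Equiv.mulLeft g).prodCongr (Equiv.refl ι)

section Trace

variable {Γ : Type*} [Group Γ] {k : ℕ}

theorem equivariant_single_apply [DecidableEq Γ]
    {A : SqSum (Γ × Fin k) →L[ℂ] SqSum (Γ × Fin k)}
    (hA : ∀ g, Commute A (permOp (leftPerm (Fin k) g))) (g γ γ' : Γ) (i j : Fin k) :
    A (lp.single 2 (g * γ, j) 1) (g * γ', i) = A (lp.single 2 (γ, j) 1) (γ', i) := by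
  have h : A (permOp (leftPerm (Fin k) g) (lp.single 2 (g * γ, j) 1)) (γ', i) =
      permOp (leftPerm (Fin k) g) (A (lp.single 2 (g * γ, j) 1)) (γ', i) :=
    congrArg (fun K : SqSum (Γ × Fin k) →L[ℂ] SqSum (Γ × Fin k) =>
      (K (lp.single 2 (g * γ, j) 1) : Γ × Fin k → ℂ) (γ', i)) (hA g).eq
  rw [permOp_single, permOp_apply] at h
  have h1 : (leftPerm (Fin k) g).symm (g * γ, j) = (γ, j) := by simp [leftPerm]
  have h2 : leftPerm (Fin k) g (γ', i) = (g * γ', i) := rfl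
  rw [h1, h2] at h
  exact h.symm

/-- The trace on equivariant operators is tracial. -/
theorem trace_mul_comm [DecidableEq Γ] {A B : SqSum (Γ × Fin k) →L[ℂ] SqSum (Γ × Fin k)}
    (hA : ∀ g, Commute A (permOp (leftPerm (Fin k) g)))
    (hB : ∀ g, Commute B (permOp (leftPerm (Fin k) g))) :
    ∑ i, (A * B) (lp.single 2 (1, i) 1) (1, i) = ∑ i, (B * A) (lp.single 2 (1, i) 1) (1, i) := by
  have expand : ∀ (C D : SqSum (Γ × Fin k) →L[ℂ] SqSum (Γ × Fin k)) (i : Fin k),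
      (C * D) (lp.single 2 (1, i) 1) (1, i) =
        ∑ j, ∑' γ, C (lp.single 2 (γ, j) 1) (1, i) * D (lp.single 2 (1, i) 1) (γ, j) := by
    intro C D i
    have h := hasSum_comp_single C D (1, i) (1, i)
    have h' := (Equiv.prodComm (Fin k) Γ).hasSum_iff.2 h
    rw [← h'.tsum_eq, h'.summable.tsum_prod, tsum_fintype]
    rfl
  simp only [expand]
  rw [Finset.sum_comm]
  refine Finset.sum_congr rfl fun i _ => Finset.sum_congr rfl fun j _ => ?_
  rw [← (Equiv.inv Γ).tsum_eq]
  refine tsum_congr fun γ => ?_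
  have e1 := equivariant_single_apply hA γ γ⁻¹ 1 j i
  have e2 := equivariant_single_apply hB γ 1 γ⁻¹ i j
  simp only [mul_inv_cancel, mul_one] at e1 e2
  rw [Equiv.inv_apply, ← e1, ← e2, mul_comm]

/-- Direct finiteness: an equivariant operator which is bounded below is onto. -/
theorem surjective_of_equivariant_of_bounded_below
    (T : SqSum (Γ × Fin k) →L[ℂ] SqSum (Γ × Fin k))
    (hT : ∀ g, Commute T (permOp (leftPerm (Fin k) g)))
    (hT' : ∀ g, Commute (adjoint T) (permOp (leftPerm (Fin k) g)))
    {c : ℝ} (hc : 0 < c) (hbelow : ∀ x, c * ‖x‖ ^ 2 ≤ ‖T x‖ ^ 2) :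
    Function.Surjective T := by
  classical
  obtain ⟨u, hu⟩ : IsUnit (adjoint T * T) := by
    refine isUnit_of_forall_le_norm_inner_map _ (c := ⟨c, hc.le⟩) hc fun x => ?_
    rw [ContinuousLinearMap.mul_def, comp_apply, adjoint_inner_left, inner_self_eq_norm_sq_to_K,
      mul_comm, norm_pow, RCLike.norm_ofReal, abs_norm]
    exact hbelow x
  set B : SqSum (Γ × Fin k) →L[ℂ] SqSum (Γ × Fin k) := ↑u⁻¹ * adjoint T with hB
  have hBT : B * T = 1 := by rw [hB, mul_assoc, ← hu, Units.inv_mul]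
  have hBU : ∀ g, Commute B (permOp (leftPerm (Fin k) g)) := by
    intro g
    refine Commute.mul_left ?_ (hT' g)
    refine Commute.units_inv_left ?_
    rw [hu]
    exact (hT' g).mul_left (hT g)
  have hTP : adjoint T * (1 - T * B) = 0 := by
    rw [mul_sub, mul_one, ← mul_assoc, ← hu, hB, ← mul_assoc, Units.mul_inv, one_mul, sub_self]
  have hnorm : ∀ i : Fin k, (1 - T * B) (lp.single 2 (1, i) 1) (1, i) =
      ((‖(1 - T * B) (lp.single 2 (1, i) 1)‖ ^ 2 : ℝ) : ℂ) := by
    intro i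
    set d : SqSum (Γ × Fin k) := lp.single 2 (1, i) 1 with hd
    have h1 : inner ℂ d ((1 - T * B) d) = (1 - T * B) d (1, i) := by
      rw [hd, lp.inner_single_left]
      simp
    have h2 : inner ℂ ((T * B) d) ((1 - T * B) d) = 0 := by
      rw [ContinuousLinearMap.mul_def T B, comp_apply, ← adjoint_inner_right,
        ← comp_apply, ← ContinuousLinearMap.mul_def, ← ContinuousLinearMap.mul_def, hTP]
      simp
    have h3 : d = (1 - T * B) d + (T * B) d := by simp
    rw [← h1]
    conv_lhs => rw [h3]
    rw [inner_add_left, ← h3, h2, add_zero, inner_self_eq_norm_sq_to_K]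
    push_cast
    rfl
  have htr : ∑ i : Fin k, ‖(1 - T * B) (lp.single 2 (1, i) 1)‖ ^ 2 = 0 := by
    rw [← Complex.ofReal_inj, Complex.ofReal_sum, Complex.ofReal_zero]
    rw [← Finset.sum_congr rfl fun i _ => hnorm i]
    have h := trace_mul_comm hT hBU
    rw [hBT] at h
    have h' : ∀ i : Fin k, (1 - T * B) (lp.single 2 (1, i) 1) (1, i) =
        (1 : SqSum (Γ × Fin k) →L[ℂ] SqSum (Γ × Fin k)) (lp.single 2 (1, i) 1) (1, i) -
          (T * B) (lp.single 2 (1, i) 1) (1, i) := fun i => by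
      rw [sub_apply, lp.coeFn_sub, Pi.sub_apply]
    rw [Finset.sum_congr rfl fun i _ => h' i, Finset.sum_sub_distrib, h, sub_self]
  have hzero : ∀ i : Fin k, (1 - T * B) (lp.single 2 (1, i) 1) = 0 := by
    intro i
    rw [Finset.sum_eq_zero_iff_of_nonneg fun _ _ => sq_nonneg _] at htr
    simpa using htr i (Finset.mem_univ i)
  have hcomm : ∀ g, Commute (1 - T * B) (permOp (leftPerm (Fin k) g)) := fun g =>
    (Commute.one_left _).sub_left ((hT g).mul_left (hBU g))
  have hall : ∀ z : Γ × Fin k, (1 - T * B) (lp.single 2 z 1) = 0 := by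
    rintro ⟨γ, j⟩
    ext ⟨γ', i⟩
    have h := equivariant_single_apply hcomm γ 1 (γ⁻¹ * γ') i j
    rw [mul_one, mul_inv_cancel_left, hzero] at h
    exact h
  have hone : 1 - T * B = 0 := by
    ext y x
    have h1 := (lp.hasSum_single (p := 2) (by norm_num) y).mapL (1 - T * B)
    have h2 : ∀ z, (1 - T * B) (lp.single 2 z (y z)) = 0 := by
      intro z
      have : lp.single (E := fun _ : Γ × Fin k => ℂ) 2 z (y z) =
          y z • lp.single 2 z (1 : ℂ) := by
        rw [← lp.single_smul, smul_eq_mul, mul_one]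
      rw [this, map_smul, hall, smul_zero]
    simp only [h2] at h1
    rw [h1.unique hasSum_zero]
    rfl
  intro y
  refine ⟨B y, ?_⟩
  exact (congrArg (fun K : SqSum (Γ × Fin k) →L[ℂ] SqSum (Γ × Fin k) => K y)
    (sub_eq_zero.1 hone)).symm

end Trace

/-- A self-adjoint operator which is bounded below is invertible. -/
theorem isUnit_of_isSelfAdjoint_of_bounded_below {H : Type*} [NormedAddCommGroup H]
    [InnerProductSpace ℂ H] [CompleteSpace H] {A : H →L[ℂ] H} (hA : IsSelfAdjoint A) {c : ℝ}
    (hc : 0 < c) (h : ∀ x, c * ‖x‖ ≤ ‖A x‖) : IsUnit A := by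
  rw [← isUnit_mul_self_iff]
  refine isUnit_of_forall_le_norm_inner_map _ (c := ⟨c ^ 2, by positivity⟩)
    (show (0 : ℝ) < c ^ 2 by positivity)
    fun x => ?_
  have hA' : adjoint A = A := hA
  have hxx : inner ℂ ((A * A) x) x = inner ℂ (A x) (A x) := by
    rw [ContinuousLinearMap.mul_def, comp_apply, ← adjoint_inner_right, hA']
  rw [hxx]
  rw [inner_self_eq_norm_sq_to_K]
  have := pow_le_pow_left₀ (by positivity) (h x) 2
  rw [mul_pow, mul_comm] at this
  rw [norm_pow, RCLike.norm_ofReal, abs_norm]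
  exact this

/-- A self-adjoint operator whose form is negative on the range of `J` and positive on the
kernel of `R` is invertible as soon as `R ∘ J` is onto whenever it is bounded below. -/
theorem isUnit_of_form_bounds {H K : Type*} [NormedAddCommGroup H]
    [InnerProductSpace ℂ H] [CompleteSpace H] [NormedAddCommGroup K]
    [InnerProductSpace ℂ K] {A : H →L[ℂ] H} (hA : IsSelfAdjoint A) (J : K →L[ℂ] H)
    (R : H →L[ℂ] K) {c₁ c₂ C : ℝ} (hc₁ : 0 < c₁) (hc₂ : 0 < c₂) (hC : 0 ≤ C)
    (hpos : ∀ f, c₁ * ‖f‖ ^ 2 ≤ (inner ℂ f (A f)).re + C * ‖R f‖ ^ 2)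
    (hneg : ∀ x, (inner ℂ (J x) (A (J x))).re + c₂ * ‖x‖ ^ 2 ≤ 0)
    (hsurj : (∃ c > 0, ∀ x, c * ‖x‖ ^ 2 ≤ ‖R (J x)‖ ^ 2) →
      Function.Surjective fun x => R (J x)) : IsUnit A := by
  have hA' : adjoint A = A := hA
  have hs := hsurj ⟨c₂ / (C + 1), by positivity, fun x => by
    have h1 := hpos (J x)
    have h2 := hneg x
    rw [div_mul_eq_mul_div, div_le_iff₀ (by positivity)]
    nlinarith [mul_nonneg hc₁.le (sq_nonneg ‖J x‖), sq_nonneg ‖R (J x)‖]⟩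
  set N := ‖J‖ ^ 2 + 1 with hN
  have hNpos : 0 < N := by positivity
  set c := min c₁ (c₂ / N) with hcdef
  have hc : 0 < c := lt_min hc₁ (by positivity)
  refine isUnit_of_isSelfAdjoint_of_bounded_below hA (c := c / 2) (by positivity) fun f => ?_
  obtain ⟨x, hx⟩ := hs (R f)
  obtain ⟨h, rfl⟩ : ∃ h, f = J x + h := ⟨f - J x, by abel⟩
  set p := J x with hp
  have hRh : R h = 0 := by
    have hx' : R p = R (p + h) := hx
    rw [map_add] at hx'
    simpa using hx'.symm
  have hh := hpos h
  rw [hRh, norm_zero] at hh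
  have hJ : ‖p‖ ^ 2 ≤ N * ‖x‖ ^ 2 := by
    have := pow_le_pow_left₀ (norm_nonneg _) (J.le_opNorm x) 2
    rw [mul_pow] at this
    nlinarith [sq_nonneg ‖x‖]
  have h1 : c * ‖h‖ ^ 2 ≤ (inner ℂ h (A h)).re := by
    have : c ≤ c₁ := min_le_left _ _
    nlinarith [sq_nonneg ‖h‖]
  have h2 : c * ‖p‖ ^ 2 ≤ - (inner ℂ p (A p)).re := by
    have h3 : c * N ≤ c₂ := by
      rw [← le_div_iff₀ hNpos]
      exact min_le_right _ _
    nlinarith [hneg x, sq_nonneg ‖x‖]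
  have hcross : (inner ℂ p (A h)).re = (inner ℂ h (A p)).re := by
    rw [← inner_conj_symm, Complex.conj_re, ← adjoint_inner_right, hA']
  have hkey : (inner ℂ (h - p) (A (p + h))).re =
      (inner ℂ h (A h)).re - (inner ℂ p (A p)).re := by
    simp only [map_add, inner_add_right, inner_sub_left, Complex.add_re, Complex.sub_re]
    linarith
  have hle : (inner ℂ (h - p) (A (p + h))).re ≤ (‖p‖ + ‖h‖) * ‖A (p + h)‖ := by
    refine (Complex.re_le_norm _).trans ((norm_inner_le_norm _ _).trans ?_)
    gcongr
    exact (norm_sub_le _ _).trans (add_comm _ _).le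
  have hf : ‖p + h‖ ≤ ‖p‖ + ‖h‖ := norm_add_le _ _
  rcases (add_nonneg (norm_nonneg p) (norm_nonneg h)).eq_or_lt with h0 | h0
  · have : ‖p + h‖ = 0 := le_antisymm (hf.trans h0.symm.le) (norm_nonneg _)
    rw [this, mul_zero]
    exact norm_nonneg _
  · have hmain : c / 2 * (‖p‖ + ‖h‖) ≤ ‖A (p + h)‖ := by
      refine le_of_mul_le_mul_left ?_ h0
      nlinarith [mul_nonneg hc.le (sq_nonneg (‖p‖ - ‖h‖))]
    refine le_trans ?_ hmain
    gcongr

end SquareSummable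

section Counting

theorem le_of_lt_natCard_of_monotone {n : ℕ} {μ : Fin n → ℝ} (hμ : Monotone μ) {l : ℝ}
    (j : Fin n) (hj : (j : ℕ) < Nat.card {i // μ i ≤ l}) : μ j ≤ l := by
  classical
  by_contra h
  rw [Nat.card_eq_fintype_card, Fintype.card_subtype] at hj
  have hsub : (univ.filter fun i => μ i ≤ l) ⊆ Finset.Iio j := by
    intro i hi
    rw [Finset.mem_Iio]
    by_contra hij
    exact h ((hμ (not_lt.1 hij)).trans (Finset.mem_filter.1 hi).2)
  have := Finset.card_le_card hsub
  rw [Fin.card_Iio] at this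
  omega

theorem lt_natCard_of_monotone {n : ℕ} {μ : Fin n → ℝ} (hμ : Monotone μ) {l : ℝ}
    (j : Fin n) (hj : μ j < l) : (j : ℕ) < Nat.card {i // μ i < l} := by
  classical
  rw [Nat.card_eq_fintype_card, Fintype.card_subtype]
  have hsub : Finset.Iic j ⊆ univ.filter fun i => μ i < l := by
    intro i hi
    exact Finset.mem_filter.2 ⟨Finset.mem_univ i, (hμ (Finset.mem_Iic.1 hi)).trans_lt hj⟩
  have := Finset.card_le_card hsub
  rw [Fin.card_Iic] at this
  omega

end Counting

section EdgeOperators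

open ContinuousLinearMap

theorem adjoint_weighted_pullback_apply {X Y : Type*} {σ : X → Y} {a : X → ℂ}
    {K : SqSum Y →L[ℂ] SqSum X} (hK : ∀ (f : SqSum Y) (x : X), K f x = a x * f (σ x))
    (g : SqSum X) (y : Y) [Fintype {x // σ x = y}] :
    adjoint K g y = ∑ x : {x // σ x = y}, conj (a x) * g x := by
  classical
  have h1 : adjoint K g y = inner ℂ (lp.single 2 y (1 : ℂ)) (adjoint K g) := by
    rw [lp.inner_single_left]
    simp
  rw [h1, adjoint_inner_right, lp.inner_eq_tsum, ← tsum_fintype (L := .unconditional _)]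
  symm
  have h2 : ∀ x, inner ℂ (K (lp.single 2 y (1 : ℂ)) x) (g x) =
      if σ x = y then conj (a x) * g x else 0 := by
    intro x
    rw [hK, lp.single_apply, Pi.single_apply]
    split_ifs <;> simp [mul_comm]
  simp only [h2]
  rw [← tsum_subtype_eq_of_support_subset (s := {x | σ x = y})]
  · refine tsum_congr fun x => ?_
    rw [if_pos x.2]
  · intro x hx
    by_contra hne
    exact hx (if_neg hne)

variable (s t : E → V)
  [∀ v : V, Fintype {e : E // s e = v}] [∀ v : V, Fintype {e : E // t e = v}]

theorem exists_vertex_to_edge_operator (σ : E → V) (d : V → ℕ)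
    [∀ v : V, Fintype {e : E // σ e = v}] (hd : ∀ v, Fintype.card {e : E // σ e = v} ≤ d v) :
    ∃ K : SqSum V →L[ℂ] SqSum E, ∀ (f : SqSum V) (e : E),
      K f e = ((Real.sqrt (d (σ e)))⁻¹ : ℂ) * f (σ e) := by
  classical
  refine exists_weighted_pullback σ (fun e => ((Real.sqrt (d (σ e)))⁻¹ : ℂ)) 1 fun v S hS => ?_
  have h1 : ∑ e ∈ S, ‖((Real.sqrt (d (σ e)))⁻¹ : ℂ)‖ ^ 2 = S.card * (d v : ℝ)⁻¹ := by
    rw [← nsmul_eq_mul, ← Finset.sum_const]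
    refine Finset.sum_congr rfl fun e he => ?_
    rw [hS e he, norm_inv, Complex.norm_real, inv_pow, Real.norm_eq_abs, sq_abs,
      Real.sq_sqrt (Nat.cast_nonneg _)]
  have h2 : S.card ≤ d v := by
    refine le_trans ?_ (hd v)
    rw [← Fintype.card_coe]
    exact Fintype.card_le_of_injective (fun e : S => (⟨e, hS e e.2⟩ : {e // σ e = v}))
      fun a b h => Subtype.ext (congrArg (fun z => z.val) h)
  rw [h1, ← div_eq_mul_inv]
  exact div_le_one_of_le₀ (by exact_mod_cast h2) (Nat.cast_nonneg _)

/-- Factorisation of the normalised Laplacian through the edge space. -/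
theorem exists_edge_factorisation (hdeg : ∀ v, degG s t v ≠ 0) :
    ∃ S T : SqSum V →L[ℂ] SqSum E,
      (∀ f e, S f e = ((Real.sqrt (degG s t (s e)))⁻¹ : ℂ) * f (s e)) ∧
      (∀ f e, T f e = ((Real.sqrt (degG s t (t e)))⁻¹ : ℂ) * f (t e)) ∧
      (∀ f, ‖S f‖ ^ 2 + ‖T f‖ ^ 2 = ‖f‖ ^ 2) ∧
      ∀ (f : SqSum V) (v : V), adjoint (T - S) ((T - S) f) v = f v -
          (∑ e : {e : E // s e = v},
            ((Real.sqrt ((degG s t v : ℝ) * (degG s t (t e.val) : ℝ)))⁻¹ : ℂ) *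
              f (t e.val)) -
          ∑ e : {e : E // t e = v},
            ((Real.sqrt ((degG s t v : ℝ) * (degG s t (s e.val) : ℝ)))⁻¹ : ℂ) *
              f (s e.val) := by
  obtain ⟨S, hS⟩ := exists_vertex_to_edge_operator s (degG s t) fun v => Nat.le_add_right _ _
  obtain ⟨T, hT⟩ := exists_vertex_to_edge_operator t (degG s t) fun v => Nat.le_add_left _ _
  have hsq : ∀ v, ((Real.sqrt (degG s t v))⁻¹ : ℂ) * ((Real.sqrt (degG s t v))⁻¹ : ℂ) =
      (degG s t v : ℂ)⁻¹ := by
    intro v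
    rw [← mul_inv, ← Complex.ofReal_mul, Real.mul_self_sqrt (Nat.cast_nonneg _),
      Complex.ofReal_natCast]
  have hSS : ∀ f v, adjoint S (S f) v =
      (Fintype.card {e : E // s e = v} : ℂ) * (degG s t v : ℂ)⁻¹ * f v := by
    intro f v
    rw [adjoint_weighted_pullback_apply hS, ← hsq, mul_assoc, ← nsmul_eq_mul, ← Finset.card_univ,
      ← Finset.sum_const]
    refine Finset.sum_congr rfl fun e _ => ?_
    rw [hS, e.2, ← Complex.ofReal_inv, Complex.conj_ofReal, mul_assoc]
  have hTT : ∀ f v, adjoint T (T f) v =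
      (Fintype.card {e : E // t e = v} : ℂ) * (degG s t v : ℂ)⁻¹ * f v := by
    intro f v
    rw [adjoint_weighted_pullback_apply hT, ← hsq, mul_assoc, ← nsmul_eq_mul, ← Finset.card_univ,
      ← Finset.sum_const]
    refine Finset.sum_congr rfl fun e _ => ?_
    rw [hT, e.2, ← Complex.ofReal_inv, Complex.conj_ofReal, mul_assoc]
  have hsum : ∀ f : SqSum V, adjoint S (S f) + adjoint T (T f) = f := by
    intro f
    ext v
    have hd : (degG s t v : ℂ) ≠ 0 := Nat.cast_ne_zero.2 (hdeg v)
    rw [lp.coeFn_add, Pi.add_apply, hSS, hTT, ← add_mul, ← add_mul, ← Nat.cast_add]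
    change (degG s t v : ℂ) * (degG s t v : ℂ)⁻¹ * f v = f v
    rw [mul_inv_cancel₀ hd, one_mul]
  have hST : ∀ f v, adjoint S (T f) v = ∑ e : {e : E // s e = v},
      ((Real.sqrt ((degG s t v : ℝ) * (degG s t (t e.val) : ℝ)))⁻¹ : ℂ) * f (t e.val) := by
    intro f v
    rw [adjoint_weighted_pullback_apply hS]
    refine Finset.sum_congr rfl fun e _ => ?_
    rw [hT, e.2, ← Complex.ofReal_inv, Complex.conj_ofReal, Real.sqrt_mul (Nat.cast_nonneg _),
      Complex.ofReal_mul, mul_inv, Complex.ofReal_inv, mul_assoc]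
  have hTS : ∀ f v, adjoint T (S f) v = ∑ e : {e : E // t e = v},
      ((Real.sqrt ((degG s t v : ℝ) * (degG s t (s e.val) : ℝ)))⁻¹ : ℂ) * f (s e.val) := by
    intro f v
    rw [adjoint_weighted_pullback_apply hT]
    refine Finset.sum_congr rfl fun e _ => ?_
    rw [hS, e.2, ← Complex.ofReal_inv, Complex.conj_ofReal, Real.sqrt_mul (Nat.cast_nonneg _),
      Complex.ofReal_mul, mul_inv, Complex.ofReal_inv, mul_assoc]
  refine ⟨S, T, hS, hT, fun f => ?_, fun f v => ?_⟩
  · have h := congrArg (fun g => (inner ℂ f g).re) (hsum f)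
    simp only [inner_add_right, adjoint_inner_right, inner_self_eq_norm_sq_to_K] at h
    norm_cast at h
  · rw [← hST, ← hTS]
    have h : adjoint (T - S) ((T - S) f) = f - adjoint S (T f) - adjoint T (S f) := by
      refine Eq.trans ?_ (congrArg (fun g => g - adjoint S (T f) - adjoint T (S f)) (hsum f))
      simp only [map_sub, _root_.sub_apply]
      abel
    rw [h]
    rfl

end EdgeOperators

section Covering

open ContinuousLinearMap

theorem hasSum_norm_sq_fibers {Γ ι X : Type*} [Fintype ι] (e : Γ × ι ≃ X)
    (f : SqSum X) : HasSum (fun γ => ∑ i, ‖f (e (γ, i))‖ ^ 2) (‖f‖ ^ 2) := by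
  have h := e.hasSum_iff.2 (SqSum.hasSum_norm_sq f)
  exact h.prod_fiberwise fun γ => hasSum_fintype _

variable {Γ : Type*} [Group Γ] [MulAction Γ V]

theorem exists_fiber_operator (hfreeV : ∀ (γ : Γ) (v : V), γ • v = v → γ = 1)
    {W : Type*} [Fintype W] (ι : W → V) {k : ℕ} (φ : Fin k → W → ℂ) :
    ∃ R : SqSum V →L[ℂ] SqSum (Γ × Fin k), ∀ (f : SqSum V) (γ : Γ) (i : Fin k),
      R f (γ, i) = ∑ w, φ i w * f (γ • ι w) := by
  classical
  have h : ∀ w : W, ∃ K : SqSum V →L[ℂ] SqSum (Γ × Fin k), ∀ (f : SqSum V) (x : Γ × Fin k),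
      K f x = φ x.2 w * f (x.1 • ι w) := by
    intro w
    refine exists_weighted_pullback (fun x : Γ × Fin k => x.1 • ι w) (fun x => φ x.2 w)
      (∑ i, ‖φ i w‖ ^ 2) fun v S hS => ?_
    have hinj : Set.InjOn Prod.snd (S : Set (Γ × Fin k)) := by
      intro x hx y hy hxy
      refine Prod.ext ?_ hxy
      have h1 : x.1 • ι w = y.1 • ι w := (hS x hx).trans (hS y hy).symm
      have h2 := hfreeV (y.1⁻¹ * x.1) (ι w) (by rw [mul_smul, h1, inv_smul_smul])
      exact (inv_mul_eq_one.1 h2).symm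
    rw [← Finset.sum_image (g := Prod.snd) (f := fun i => ‖φ i w‖ ^ 2) hinj]
    exact Finset.sum_le_sum_of_subset_of_nonneg (Finset.subset_univ _) fun _ _ _ => sq_nonneg _
  choose K hK using h
  refine ⟨∑ w, K w, fun f γ i => ?_⟩
  rw [_root_.sum_apply, lp.coeFn_sum, Finset.sum_apply]
  exact Finset.sum_congr rfl fun w _ => hK w f (γ, i)

theorem fiber_operator_comp_permOp {W : Type*} [Fintype W] {ι : W → V} {k : ℕ}
    {φ : Fin k → W → ℂ} {R : SqSum V →L[ℂ] SqSum (Γ × Fin k)}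
    (hR : ∀ (f : SqSum V) (γ : Γ) (i : Fin k), R f (γ, i) = ∑ w, φ i w * f (γ • ι w)) (g : Γ) :
    R ∘L permOp (MulAction.toPerm g) = permOp (leftPerm (Fin k) g) ∘L R := by
  ext f ⟨γ, i⟩
  have h : leftPerm (Fin k) g (γ, i) = (g * γ, i) := rfl
  rw [comp_apply, comp_apply, permOp_apply, h, hR, hR]
  refine Finset.sum_congr rfl fun w _ => ?_
  rw [permOp_apply, MulAction.toPerm_apply, mul_smul]

theorem permOp_comp_adjoint_fiber_operator {W : Type*} [Fintype W] {ι : W → V} {k : ℕ}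
    {φ : Fin k → W → ℂ} {R : SqSum V →L[ℂ] SqSum (Γ × Fin k)}
    (hR : ∀ (f : SqSum V) (γ : Γ) (i : Fin k), R f (γ, i) = ∑ w, φ i w * f (γ • ι w)) (g : Γ) :
    adjoint R ∘L permOp (leftPerm (Fin k) g) = permOp (MulAction.toPerm g) ∘L adjoint R := by
  have h := congrArg adjoint (fiber_operator_comp_permOp hR g⁻¹)
  rw [adjoint_comp, adjoint_comp, adjoint_permOp, adjoint_permOp] at h
  have h1 : (MulAction.toPerm g⁻¹ : Equiv.Perm V).symm = MulAction.toPerm g := by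
    ext v
    simp
  have h2 : (leftPerm (Fin k) g⁻¹).symm = leftPerm (Fin k) g := by
    ext x <;> simp [leftPerm]
  rw [h1, h2] at h
  exact h.symm

theorem commute_fiber_operators {W : Type*} [Fintype W] {ι : W → V} {k : ℕ}
    {φ ψ : Fin k → W → ℂ} {R P : SqSum V →L[ℂ] SqSum (Γ × Fin k)}
    (hR : ∀ (f : SqSum V) (γ : Γ) (i : Fin k), R f (γ, i) = ∑ w, φ i w * f (γ • ι w))
    (hP : ∀ (f : SqSum V) (γ : Γ) (i : Fin k), P f (γ, i) = ∑ w, ψ i w * f (γ • ι w)) (g : Γ) :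
    Commute (R ∘L adjoint P) (permOp (leftPerm (Fin k) g)) := by
  rw [commute_iff_eq, ContinuousLinearMap.mul_def, ContinuousLinearMap.mul_def, comp_assoc,
    permOp_comp_adjoint_fiber_operator hP, ← comp_assoc, fiber_operator_comp_permOp hR, comp_assoc]

theorem adjoint_fiber_operator_apply {W : Type*} [Fintype W] {ι : W → V} {k : ℕ}
    {ψ : Fin k → W → ℂ} {P : SqSum V →L[ℂ] SqSum (Γ × Fin k)}
    (hP : ∀ (f : SqSum V) (γ : Γ) (i : Fin k), P f (γ, i) = ∑ w, ψ i w * f (γ • ι w))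
    (hψ : ∀ (γ γ' : Γ) (w w' : W), γ' • ι w' = γ • ι w → (γ' = γ ∧ w' = w) ∨ ∀ i, ψ i w' = 0)
    (x : SqSum (Γ × Fin k)) (γ : Γ) (w : W) :
    adjoint P x (γ • ι w) = ∑ i, conj (ψ i w) * x (γ, i) := by
  classical
  have h1 : adjoint P x (γ • ι w) =
      inner ℂ (lp.single 2 (γ • ι w) (1 : ℂ)) (adjoint P x) := by
    rw [lp.inner_single_left]
    simp
  have h2 : ∀ z : Γ × Fin k, P (lp.single 2 (γ • ι w) (1 : ℂ)) z =
      if z.1 = γ then ψ z.2 w else 0 := by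
    rintro ⟨γ', i⟩
    rw [hP]
    by_cases hγ : γ' = γ
    · subst hγ
      rw [if_pos rfl, Finset.sum_eq_single w]
      · rw [lp.single_apply_self, mul_one]
      · intro w' _ hw'
        rw [lp.single_apply, Pi.single_apply]
        split_ifs with h
        · rcases hψ γ' γ' w w' h with h | h
          · exact absurd h.2 hw'
          · rw [h, zero_mul]
        · rw [mul_zero]
      · intro h
        exact absurd (Finset.mem_univ w) h
    · rw [if_neg hγ]
      refine Finset.sum_eq_zero fun w' _ => ?_
      rw [lp.single_apply, Pi.single_apply]
      split_ifs with h
      · rcases hψ γ γ' w w' h with h | h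
        · exact absurd h.1 hγ
        · rw [h, zero_mul]
      · rw [mul_zero]
  rw [h1, adjoint_inner_right, lp.inner_eq_tsum,
    tsum_eq_sum (s := ({γ} : Finset Γ) ×ˢ univ)]
  · rw [Finset.sum_product, Finset.sum_singleton]
    refine Finset.sum_congr rfl fun i _ => ?_
    rw [h2, if_pos rfl]
    simp [mul_comm]
  · rintro ⟨γ', i⟩ hz
    have hne : γ' ≠ γ := fun h => hz (by simp [h])
    rw [h2, if_neg hne]
    simp

end Covering

section Bracketing

open ContinuousLinearMap

variable {Γ : Type*} [Group Γ] [MulAction Γ V] [MulAction Γ E] {s t : E → V}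

theorem card_fiber_smul {σ : E → V} [∀ v : V, Fintype {e : E // σ e = v}]
    (hσ : ∀ (γ : Γ) (e : E), σ (γ • e) = γ • σ e) (γ : Γ) (v : V) :
    Fintype.card {e : E // σ e = γ • v} = Fintype.card {e : E // σ e = v} := by
  refine (Fintype.card_congr ((MulAction.toPerm γ).subtypeEquiv fun e => ?_)).symm
  rw [MulAction.toPerm_apply, hσ, smul_left_cancel_iff]

theorem degG_smul [∀ v : V, Fintype {e : E // s e = v}] [∀ v : V, Fintype {e : E // t e = v}]
    (hs : ∀ (γ : Γ) (e : E), s (γ • e) = γ • s e) (ht : ∀ (γ : Γ) (e : E), t (γ • e) = γ • t e)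
    (γ : Γ) (v : V) : degG s t (γ • v) = degG s t v := by
  rw [degG, degG, card_fiber_smul hs, card_fiber_smul ht]

theorem degG_ne_zero_of_mem_VH [DecidableEq V]
    [∀ v : V, Fintype {e : E // s e = v}] [∀ v : V, Fintype {e : E // t e = v}]
    {EH : Finset E} {w : V} (hw : w ∈ VH s t EH) : degG s t w ≠ 0 := by
  rcases Finset.mem_union.1 hw with h | h <;> obtain ⟨e, _, rfl⟩ := Finset.mem_image.1 h
  · have h1 : 0 < Fintype.card {e' : E // s e' = s e} := Fintype.card_pos_iff.2 ⟨⟨e, rfl⟩⟩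
    rw [degG]
    omega
  · have h1 : 0 < Fintype.card {e' : E // t e' = t e} := Fintype.card_pos_iff.2 ⟨⟨e, rfl⟩⟩
    rw [degG]
    omega

/-- Translates of an interior vertex meet the fundamental domain only in the trivial way. -/
theorem eq_of_smul_eq_smul_of_notMem_boundary [DecidableEq V]
    (hs : ∀ (γ : Γ) (e : E), s (γ • e) = γ • s e) (ht : ∀ (γ : Γ) (e : E), t (γ • e) = γ • t e)
    {EH : Finset E} (hEH : ∀ e : E, ∃! p : Γ × ↥EH, p.1 • (p.2 : E) = e) {bd : Finset V}
    (hinner : ∀ v ∈ VH s t EH \ bd, ∀ e : E, (s e = v ∨ t e = v) → e ∈ EH)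
    {γ γ' : Γ} {w w' : V} (hw : w ∈ VH s t EH) (hw' : w' ∈ VH s t EH) (hbd : w' ∉ bd)
    (h : γ' • w' = γ • w) : γ' = γ ∧ w' = w := by
  obtain ⟨e, he, hew⟩ : ∃ e ∈ EH, s e = w ∨ t e = w := by
    rcases Finset.mem_union.1 hw with h | h <;> obtain ⟨e, he, hew⟩ := Finset.mem_image.1 h
    · exact ⟨e, he, Or.inl hew⟩
    · exact ⟨e, he, Or.inr hew⟩
  have hw'' : w' = γ'⁻¹ • γ • w := by rw [← h, inv_smul_smul]
  have he' : γ'⁻¹ • γ • e ∈ EH := by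
    refine hinner w' (Finset.mem_sdiff.2 ⟨hw', hbd⟩) _ (hew.imp ?_ ?_) <;> intro hew
    · rw [hs, hs, hew, hw'']
    · rw [ht, ht, hew, hw'']
  have huniq := (hEH (γ • e)).unique (y₁ := (γ', ⟨_, he'⟩)) (y₂ := (γ, ⟨e, he⟩))
    (smul_inv_smul _ _) rfl
  have hγ : γ' = γ := congrArg Prod.fst huniq
  refine ⟨hγ, ?_⟩
  rw [hw'', hγ, inv_smul_smul]

/-- The restriction of `f` to the translate by `γ` of the fundamental domain, unnormalised. -/
noncomputable def localRestriction [DecidableEq V] (s t : E → V)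
    [∀ v : V, Fintype {e : E // s e = v}] [∀ v : V, Fintype {e : E // t e = v}]
    (EH : Finset E) (f : SqSum V) (γ : Γ) (w : ↥(VH s t EH)) : ℂ :=
  ((Real.sqrt (degG s t w.val))⁻¹ : ℂ) * f (γ • w.val)

variable [DecidableEq V] [∀ v : V, Fintype {e : E // s e = v}]
  [∀ v : V, Fintype {e : E // t e = v}] {EH : Finset E}

theorem hasSum_edgeNormSq (hs : ∀ (γ : Γ) (e : E), s (γ • e) = γ • s e)
    (ht : ∀ (γ : Γ) (e : E), t (γ • e) = γ • t e)
    (hEH : ∀ e : E, ∃! p : Γ × ↥EH, p.1 • (p.2 : E) = e) {S T : SqSum V →L[ℂ] SqSum E}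
    (hS : ∀ f e, S f e = ((Real.sqrt (degG s t (s e)))⁻¹ : ℂ) * f (s e))
    (hT : ∀ f e, T f e = ((Real.sqrt (degG s t (t e)))⁻¹ : ℂ) * f (t e))
    (hST : ∀ f, ‖S f‖ ^ 2 + ‖T f‖ ^ 2 = ‖f‖ ^ 2) (f : SqSum V) :
    HasSum (fun γ : Γ => edgeNormSq (srcH s t EH) (tgtH s t EH) (localRestriction s t EH f γ))
        (‖f‖ ^ 2) ∧
      HasSum (fun γ : Γ => edgeEnergy (srcH s t EH) (tgtH s t EH) (localRestriction s t EH f γ))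
        (‖(T - S) f‖ ^ 2) := by
  have hbij : Function.Bijective fun p : Γ × ↥EH => p.1 • (p.2 : E) := by
    rw [Function.bijective_iff_existsUnique]
    exact hEH
  have hSe : ∀ (γ : Γ) (e : ↥EH), S f (Equiv.ofBijective _ hbij (γ, e)) =
      localRestriction s t EH f γ (srcH s t EH e) := by
    intro γ e
    rw [hS, Equiv.ofBijective_apply, hs, degG_smul hs ht]
    rfl
  have hTe : ∀ (γ : Γ) (e : ↥EH), T f (Equiv.ofBijective _ hbij (γ, e)) =
      localRestriction s t EH f γ (tgtH s t EH e) := by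
    intro γ e
    rw [hT, Equiv.ofBijective_apply, ht, degG_smul hs ht]
    rfl
  constructor
  · have h := (hasSum_norm_sq_fibers (Equiv.ofBijective _ hbij) (S f)).add
      (hasSum_norm_sq_fibers (Equiv.ofBijective _ hbij) (T f))
    simp only [hSe, hTe, ← Finset.sum_add_distrib, hST] at h
    exact h
  · have h := hasSum_norm_sq_fibers (Equiv.ofBijective _ hbij) ((T - S) f)
    have hD : ∀ e, (T - S) f e = T f e - S f e := fun e => rfl
    simp only [hD, hSe, hTe] at h
    exact h

theorem isSelfAdjoint_adjoint_comp_self {H K : Type*} [NormedAddCommGroup H]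
    [InnerProductSpace ℂ H] [CompleteSpace H] [NormedAddCommGroup K] [InnerProductSpace ℂ K]
    [CompleteSpace K] (D : H →L[ℂ] K) : IsSelfAdjoint (adjoint D ∘L D) := by
  rw [isSelfAdjoint_iff', adjoint_comp, adjoint_adjoint]

theorem re_inner_adjoint_comp_self_sub {H K : Type*} [NormedAddCommGroup H]
    [InnerProductSpace ℂ H] [CompleteSpace H] [NormedAddCommGroup K] [InnerProductSpace ℂ K]
    [CompleteSpace K] (D : H →L[ℂ] K) (l : ℝ) (f : H) :
    (inner ℂ f ((adjoint D ∘L D - algebraMap ℂ (H →L[ℂ] H) l) f)).re =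
      ‖D f‖ ^ 2 - l * ‖f‖ ^ 2 := by
  have h : (adjoint D ∘L D - algebraMap ℂ (H →L[ℂ] H) l) f = adjoint D (D f) - (l : ℂ) • f := by
    simp [Algebra.algebraMap_eq_smul_one]
  rw [h, inner_sub_right, inner_smul_right, adjoint_inner_right, inner_self_eq_norm_sq_to_K,
    inner_self_eq_norm_sq_to_K]
  simp [← Complex.ofReal_pow]

theorem isSelfAdjoint_adjoint_comp_self_sub {H K : Type*} [NormedAddCommGroup H]
    [InnerProductSpace ℂ H] [CompleteSpace H] [NormedAddCommGroup K] [InnerProductSpace ℂ K]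
    [CompleteSpace K] (D : H →L[ℂ] K) (l : ℝ) :
    IsSelfAdjoint (adjoint D ∘L D - algebraMap ℂ (H →L[ℂ] H) l) :=
  (isSelfAdjoint_adjoint_comp_self D).sub (IsSelfAdjoint.algebraMap _ (Complex.conj_ofReal l))

/-- The normalised Laplacian is at most `2`. -/
theorem isUnit_sub_algebraMap_of_two_lt {H K : Type*} [NormedAddCommGroup H]
    [InnerProductSpace ℂ H] [CompleteSpace H] [NormedAddCommGroup K] [InnerProductSpace ℂ K]
    [CompleteSpace K] {S T : H →L[ℂ] K} (hST : ∀ f, ‖S f‖ ^ 2 + ‖T f‖ ^ 2 = ‖f‖ ^ 2) {l : ℝ}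
    (hl : 2 < l) : IsUnit (adjoint (T - S) ∘L (T - S) - algebraMap ℂ (H →L[ℂ] H) l) := by
  refine isUnit_of_isSelfAdjoint_of_bounded_below (isSelfAdjoint_adjoint_comp_self_sub _ l)
    (sub_pos.2 hl) fun f => ?_
  have h1 := re_inner_adjoint_comp_self_sub (T - S) l f
  set A := adjoint (T - S) ∘L (T - S) - algebraMap ℂ (H →L[ℂ] H) l
  have h2 : ‖(T - S) f‖ ≤ ‖T f‖ + ‖S f‖ := norm_sub_le _ _
  have h3 : ‖(T - S) f‖ ^ 2 ≤ 2 * ‖f‖ ^ 2 := by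
    nlinarith [hST f, norm_nonneg ((T - S) f), sq_nonneg (‖T f‖ - ‖S f‖)]
  have h4 : |(inner ℂ f (A f)).re| ≤ ‖f‖ * ‖A f‖ :=
    (Complex.abs_re_le_norm _).trans (norm_inner_le_norm f (A f))
  have h5 := (abs_le.1 h4).1
  rcases eq_or_lt_of_le (norm_nonneg f) with h0 | h0
  · rw [← h0, mul_zero]
    exact norm_nonneg _
  · refine le_of_mul_le_mul_left ?_ h0
    nlinarith

/-- Comparing the spectral counting functions of the Kirchhoff and the Dirichlet Laplacian of a
fundamental domain yields points of the resolvent set of the covering. -/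
theorem isUnit_sub_algebraMap_of_natCard_le [DecidableEq E]
    (hs : ∀ (γ : Γ) (e : E), s (γ • e) = γ • s e) (ht : ∀ (γ : Γ) (e : E), t (γ • e) = γ • t e)
    (hfreeV : ∀ (γ : Γ) (v : V), γ • v = v → γ = 1)
    (hEH : ∀ e : E, ∃! p : Γ × ↥EH, p.1 • (p.2 : E) = e) {bd : Finset V}
    (hinner : ∀ v ∈ VH s t EH \ bd, ∀ e : E, (s e = v ∨ t e = v) → e ∈ EH)
    {m n : ℕ} {μ : Fin m → ℝ}
    (hcount : ∀ x : ℝ, (univ.filter fun i => μ i = x).card =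
      Module.finrank ℂ (LinearMap.ker (lapH s t EH -
        (x : ℂ) • (LinearMap.id : (↥(VH s t EH) → ℂ) →ₗ[ℂ] (↥(VH s t EH) → ℂ)))))
    {μD : Fin n → ℝ}
    (hcountD : ∀ x : ℝ, (univ.filter fun i => μD i = x).card =
      Module.finrank ℂ (LinearMap.ker (dirLapH s t EH bd -
        (x : ℂ) • (LinearMap.id : dirDomH s t EH bd →ₗ[ℂ] dirDomH s t EH bd))))
    {S T : SqSum V →L[ℂ] SqSum E}
    (hS : ∀ f e, S f e = ((Real.sqrt (degG s t (s e)))⁻¹ : ℂ) * f (s e))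
    (hT : ∀ f e, T f e = ((Real.sqrt (degG s t (t e)))⁻¹ : ℂ) * f (t e))
    (hST : ∀ f, ‖S f‖ ^ 2 + ‖T f‖ ^ 2 = ‖f‖ ^ 2) {l : ℝ}
    (hl : Nat.card {i // μ i ≤ l} ≤ Nat.card {i // μD i < l}) :
    IsUnit (adjoint (T - S) ∘L (T - S) - algebraMap ℂ (SqSum V →L[ℂ] SqSum V) l) := by
  obtain ⟨φ, c, C, hc, hC, hφ⟩ := exists_kirchhoff_bound s t EH μ hcount l rfl
  obtain ⟨ψ, c', hc', hψ, hψx⟩ := exists_dirichlet_bound s t EH bd μD hcountD l hl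
  obtain ⟨R, hR⟩ := exists_fiber_operator hfreeV (Subtype.val : ↥(VH s t EH) → V)
    fun i w => φ i w * ((Real.sqrt (degG s t w.val))⁻¹ : ℂ)
  obtain ⟨P, hP⟩ := exists_fiber_operator hfreeV (Subtype.val : ↥(VH s t EH) → V)
    fun i w => conj (ψ i w) * (Real.sqrt (degG s t w.val) : ℂ)
  have hRf : ∀ (f : SqSum V) (γ : Γ) i,
      R f (γ, i) = ∑ w, φ i w * localRestriction s t EH f γ w := by
    intro f γ i
    rw [hR]
    exact Finset.sum_congr rfl fun w _ => mul_assoc _ _ _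
  have hPx : ∀ x (γ : Γ), localRestriction s t EH (adjoint P x) γ =
      fun w => ∑ i, x (γ, i) * ψ i w := by
    intro x γ
    funext w
    rw [localRestriction, adjoint_fiber_operator_apply hP, Finset.mul_sum]
    · refine Finset.sum_congr rfl fun i _ => ?_
      have hd : (Real.sqrt (degG s t w.val) : ℂ) ≠ 0 := by
        rw [Complex.ofReal_ne_zero, Real.sqrt_ne_zero (Nat.cast_nonneg _), Nat.cast_ne_zero]
        exact degG_ne_zero_of_mem_VH w.2
      rw [map_mul, Complex.conj_conj, Complex.conj_ofReal]
      field_simp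
    · intro γ γ' w w' h
      by_cases hbd : w'.val ∈ bd
      · refine Or.inr fun i => ?_
        rw [hψ i w' hbd, map_zero, zero_mul]
      · have h := eq_of_smul_eq_smul_of_notMem_boundary hs ht hEH hinner w.2 w'.2 hbd h
        exact Or.inl ⟨h.1, Subtype.ext h.2⟩
  refine isUnit_of_form_bounds (isSelfAdjoint_adjoint_comp_self_sub _ l) (adjoint P) R hc hc' hC
    (fun f => ?_) (fun x => ?_) ?_
  · obtain ⟨h1, h2⟩ := hasSum_edgeNormSq hs ht hEH hS hT hST f
    have h3 := hasSum_norm_sq_fibers (Equiv.refl (Γ × Fin _)) (R f)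
    have h := hasSum_le (fun γ => ?_) (h1.mul_left (c + l)) (h2.add (h3.mul_left C))
    · rw [re_inner_adjoint_comp_self_sub]
      linarith
    · simp only [Equiv.refl_apply, hRf]
      exact hφ _
  · obtain ⟨h1, h2⟩ := hasSum_edgeNormSq hs ht hEH hS hT hST (adjoint P x)
    have h3 := hasSum_norm_sq_fibers (Equiv.refl (Γ × Fin _)) x
    have h := hasSum_le (fun γ => ?_) (h2.add (h3.mul_left c')) (h1.mul_left l)
    · rw [re_inner_adjoint_comp_self_sub]
      linarith
    · rw [hPx]
      exact hψx _
  · rintro ⟨a, ha, hbelow⟩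
    refine surjective_of_equivariant_of_bounded_below (R ∘L adjoint P)
      (commute_fiber_operators hR hP) (fun g => ?_) ha hbelow
    rw [adjoint_comp, adjoint_adjoint]
    exact commute_fiber_operators hP hR g

/-- Below `2`, the counting functions can only differ inside the bracketing intervals. -/
theorem natCard_le_natCard_of_notMem_intervals {m n : ℕ} {μ : Fin n → ℝ} (hμ : Monotone μ)
    {μD : Fin m → ℝ} (hμD : Monotone μD) {l : ℝ} (hl : l ≤ 2)
    (hnot : ∀ k : Fin n,
      l ∉ Set.Icc (μ k) (if h : (k : ℕ) < m then μD ⟨k, h⟩ else 2)) :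
    Nat.card {i // μ i ≤ l} ≤ Nat.card {i // μD i < l} := by
  have hcard : Nat.card {i // μ i ≤ l} ≤ n := by
    simpa using Nat.card_le_card_of_injective (Subtype.val : {i // μ i ≤ l} → Fin n)
      Subtype.val_injective
  rcases Nat.eq_zero_or_pos (Nat.card {i // μ i ≤ l}) with h0 | h0
  · omega
  · have hj : Nat.card {i // μ i ≤ l} - 1 < n := by omega
    have h1 : μ ⟨_, hj⟩ ≤ l := le_of_lt_natCard_of_monotone hμ ⟨_, hj⟩ (by simp only; omega)
    have h2 := hnot ⟨_, hj⟩
    split_ifs at h2 with hm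
    · have h3 : μD ⟨_, hm⟩ < l := not_le.1 fun h => h2 ⟨h1, h⟩
      have h4 := lt_natCard_of_monotone hμD ⟨_, hm⟩ h3
      simp only at h4
      omega
    · exact absurd ⟨h1, hl⟩ h2

end Bracketing

/-- **Kirchhoff–Dirichlet bracketing for residually finite coverings (discrete case).**
Let `G` be a `Γ`-periodic graph with fundamental domain `(E_H, V_H, ∂V)` and
residually finite covering group `Γ`. Then the standard Laplacian of `G`,
transported to `ℓ²(V)`, is a bounded self-adjoint operator whose spectrum is
contained in the union of the discrete Kirchhoff–Dirichlet intervals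
`J_k = [μ_k, μ_k^{∂V}]` of the fundamental domain (with the convention
`μ_k^{∂V} = 2` for `k > |V_H| − |∂V|`). -/
theorem spectrum_subset_KD_intervals_of_residually_finite
    {Γ : Type*} [Group Γ] [DecidableEq V] [DecidableEq E]
    [MulAction Γ V] [MulAction Γ E]
    (s t : E → V)
    (hs : ∀ (γ : Γ) (e : E), s (γ • e) = γ • s e)
    (ht : ∀ (γ : Γ) (e : E), t (γ • e) = γ • t e)
    (hfreeV : ∀ (γ : Γ) (v : V), γ • v = v → γ = 1)
    (hfreeE : ∀ (γ : Γ) (e : E), γ • e = e → γ = 1)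
    (hOrbV : Finite (Quotient (MulAction.orbitRel Γ V)))
    (hOrbE : Finite (Quotient (MulAction.orbitRel Γ E)))
    [∀ v : V, Fintype {e : E // s e = v}] [∀ v : V, Fintype {e : E // t e = v}]
    (EH : Finset E)
    (hEH : ∀ e : E, ∃! p : Γ × ↥EH, p.1 • (p.2 : E) = e)
    (bd : Finset V) (hbdsub : bd ⊆ VH s t EH)
    (hinner : ∀ v ∈ VH s t EH \ bd, ∀ e : E, (s e = v ∨ t e = v) → e ∈ EH)
    (hdisj : ∀ (γ₁ γ₂ : Γ) (v₁ v₂ : V), v₁ ∈ VH s t EH \ bd → v₂ ∈ VH s t EH \ bd →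
      γ₁ • v₁ = γ₂ • v₂ → γ₁ = γ₂)
    (hcover : ∀ v : V, ∃ γ : Γ, ∃ w ∈ VH s t EH, v = γ • w)
    (hresfin : ∀ γ : Γ, γ ≠ 1 → ∃ N : Subgroup Γ, N.Normal ∧ N.FiniteIndex ∧ γ ∉ N)
    (μ : Fin ((VH s t EH).card) → ℝ) (hmono : Monotone μ)
    (hcount : ∀ x : ℝ, (univ.filter fun i => μ i = x).card =
      Module.finrank ℂ (LinearMap.ker (lapH s t EH -
        (x : ℂ) • (LinearMap.id : (↥(VH s t EH) → ℂ) →ₗ[ℂ] (↥(VH s t EH) → ℂ)))))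
    (μD : Fin ((VH s t EH).card - bd.card) → ℝ) (hmonoD : Monotone μD)
    (hcountD : ∀ x : ℝ, (univ.filter fun i => μD i = x).card =
      Module.finrank ℂ (LinearMap.ker (dirLapH s t EH bd -
        (x : ℂ) • (LinearMap.id : dirDomH s t EH bd →ₗ[ℂ] dirDomH s t EH bd)))) :
    ∃ L : lp (fun _ : V => ℂ) 2 →L[ℂ] lp (fun _ : V => ℂ) 2,
      IsSelfAdjoint L ∧
      (∀ (f : lp (fun _ : V => ℂ) 2) (v : V),
        (L f : ∀ _ : V, ℂ) v = (f : ∀ _ : V, ℂ) v -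
          (∑ e : {e : E // s e = v},
            ((Real.sqrt ((degG s t v : ℝ) * (degG s t (t e.val) : ℝ)))⁻¹ : ℂ) *
              (f : ∀ _ : V, ℂ) (t e.val)) -
          ∑ e : {e : E // t e = v},
            ((Real.sqrt ((degG s t v : ℝ) * (degG s t (s e.val) : ℝ)))⁻¹ : ℂ) *
              (f : ∀ _ : V, ℂ) (s e.val)) ∧
      spectrum ℂ L ⊆
        ⋃ k : Fin ((VH s t EH).card),
          Complex.ofReal '' Set.Icc (μ k)
            (if h : (k : ℕ) < (VH s t EH).card - bd.card then μD ⟨k, h⟩ else 2) := by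
  have hdeg : ∀ v, degG s t v ≠ 0 := by
    intro v
    obtain ⟨γ, w, hw, rfl⟩ := hcover v
    rw [degG_smul hs ht]
    exact degG_ne_zero_of_mem_VH hw
  obtain ⟨S, T, hS, hT, hST, hL⟩ := exists_edge_factorisation s t hdeg
  have hsa := isSelfAdjoint_adjoint_comp_self (T - S)
  refine ⟨_, hsa, hL, fun z hz => ?_⟩
  have hzr : z = (z.re : ℂ) := hsa.mem_spectrum_eq_re hz
  by_contra hnot
  rw [spectrum.mem_iff, ← IsUnit.neg_iff, neg_sub, hzr] at hz
  refine hz ?_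
  rcases lt_or_ge 2 z.re with h2 | h2
  · exact isUnit_sub_algebraMap_of_two_lt hST h2
  · refine isUnit_sub_algebraMap_of_natCard_le hs ht hfreeV hEH hinner hcount hcountD hS hT hST
      (natCard_le_natCard_of_notMem_intervals hmono hmonoD h2 fun k hk => hnot ?_)
    exact Set.mem_iUnion.2 ⟨k, z.re, hk, hzr.symm⟩
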